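/- Let A, B, X, X₊ be real matrices with X, X₊ symmetric positive definite and A X Aᵀ − X₊ + B Bᵀ ≺ 0. Partition conformably X = diag(Γ, Ω), X₊ = diag(Γ₊, Ω₊) with Γ, Γ₊, Ω, Ω₊ symmetric positive definite, A = [[A₁₁, A₁₂],[A₂₁, A₂₂]], B = [B₁ᵀ, B₂ᵀ]ᵀ. Then the truncated blocks satisfy A₁₁ Γ A₁₁ᵀ − Γ₊ + B₁ B₁ᵀ ≺ 0. -/

import Mathlib

open Matrix

theorem stmt_12 (r s m : ℕ)
    (A : Matrix (Fin r ⊕ Fin s) (Fin r ⊕ Fin s) ℝ)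
    (B : Matrix (Fin r ⊕ Fin s) (Fin m) ℝ)
    (Γ Γp : Matrix (Fin r) (Fin r) ℝ) (Ω Ωp : Matrix (Fin s) (Fin s) ℝ)
    (hΓ : Γ.PosDef) (hΓp : Γp.PosDef) (hΩ : Ω.PosDef) (hΩp : Ωp.PosDef)
    (h : (-(A * Matrix.fromBlocks Γ 0 0 Ω * Aᵀ
          - Matrix.fromBlocks Γp 0 0 Ωp + B * Bᵀ)).PosDef) :
    (-(A.toBlocks₁₁ * Γ * (A.toBlocks₁₁)ᵀ - Γp
        + (B.submatrix Sum.inl id) * (B.submatrix Sum.inl id)ᵀ)).PosDef := by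
  have h1 := h.submatrix (e := (Sum.inl : Fin r → Fin r ⊕ Fin s)) Sum.inl_injective
  have h2 := hΩ.posSemidef.mul_mul_conjTranspose_same A.toBlocks₁₂
  have h3 := h1.add_posSemidef h2
  convert h3 using 1
  ext i j
  simp [Matrix.mul_apply, Matrix.toBlocks₁₁, Matrix.toBlocks₁₂, Fintype.sum_sum_type]
  ring
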